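/- Let f(y₁, y₂) = ind(y₂ − y₁³) and let (P₁f)(y₂) = ∫_ℝ f(y₁, y₂) ρ(y₁) dy₁. Then (P₁f)(y₂) = Φ(∛y₂) for every y₂ ∈ ℝ, where ∛ denotes the real cube root, and ((P₁f)(y₂) − 1/2)/∛y₂ → ρ(0) as y₂ → 0 (y₂ ≠ 0). Consequently P₁f has a cube-root singularity at y₂ = 0: its difference quotient ((P₁f)(y₂) − 1/2)/y₂ tends to +∞ as y₂ → 0, so P₁f is not differentiable at 0. -/

import Mathlib

open Filter Topology Set

/-- The standard normal density. -/
noncomputable def ρ (y : ℝ) : ℝ := Real.exp (-y ^ 2 / 2) / Real.sqrt (2 * Real.pi)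

/-- The standard normal cumulative distribution function. -/
noncomputable def Φ (x : ℝ) : ℝ := ∫ y in Set.Iic x, ρ y

/-- The indicator `ind u = 1` if `u > 0` and `0` otherwise. -/
noncomputable def ind (u : ℝ) : ℝ := if 0 < u then 1 else 0

/-- The real cube root: `cbrt y` is the unique real number whose cube is `y`. -/
noncomputable def cbrt (y : ℝ) : ℝ := Real.sign y * |y| ^ ((1 : ℝ) / 3)

theorem cbrt_cube (y : ℝ) : cbrt y ^ 3 = y := by
  have h : (|y| ^ ((1 : ℝ) / 3)) ^ 3 = |y| := by
    rw [← Real.rpow_natCast, ← Real.rpow_mul (abs_nonneg y)]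
    norm_num
  unfold cbrt
  rw [mul_pow, h]
  rcases lt_trichotomy y 0 with hy | hy | hy
  · rw [Real.sign_of_neg hy, abs_of_neg hy]; ring
  · simp [hy]
  · rw [Real.sign_of_pos hy, abs_of_pos hy]; ring

theorem cbrt_tendsto : Tendsto cbrt (𝓝[≠] 0) (𝓝[≠] 0) := by
  rw [tendsto_nhdsWithin_iff]
  constructor
  · have h1 : Tendsto (fun y : ℝ => |y| ^ ((1 : ℝ) / 3)) (𝓝[≠] 0) (𝓝 0) := by
      have : Continuous (fun y : ℝ => |y| ^ ((1 : ℝ) / 3)) :=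
        continuous_abs.rpow_const (fun _ => Or.inr (by norm_num))
      have h := this.tendsto 0
      simp only [abs_zero] at h
      rw [Real.zero_rpow (by norm_num)] at h
      exact h.mono_left nhdsWithin_le_nhds
    refine squeeze_zero_norm (fun y => ?_) h1
    have h0 : 0 ≤ |y| ^ ((1 : ℝ) / 3) := by positivity
    unfold cbrt
    rw [norm_mul, Real.norm_of_nonneg h0]
    rcases Real.sign_apply_eq y with h | h | h <;> rw [h] <;> simp <;> positivity
  · filter_upwards [self_mem_nhdsWithin] with y hy h
    apply hy
    have := cbrt_cube y
    rw [show cbrt y = 0 from h] at this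
    simp at this
    exact this.symm

theorem rho_cont : Continuous ρ := by
  unfold ρ
  fun_prop

theorem rho_eq : ρ = fun y => Real.exp (-(1/2) * y ^ 2) / Real.sqrt (2 * Real.pi) := by
  funext y
  unfold ρ
  congr 2
  ring

theorem rho_int : MeasureTheory.Integrable ρ := by
  rw [rho_eq]
  exact (integrable_exp_neg_mul_sq (by norm_num)).div_const _

theorem Phi_zero : Φ 0 = 1 / 2 := by
  unfold Φ
  have h := integral_comp_neg_Iic (0 : ℝ) ρ
  have h2 : ∀ y, ρ (-y) = ρ y := fun y => by simp [ρ]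
  simp only [h2, neg_zero] at h
  rw [h, rho_eq, MeasureTheory.integral_div, integral_gaussian_Ioi]
  have : Real.sqrt (2 * Real.pi) ≠ 0 := by positivity
  rw [show Real.pi / (1 / 2) = 2 * Real.pi by ring]
  field_simp

theorem Phi_deriv : HasDerivAt Φ (ρ 0) 0 := by
  have h : Φ = fun x => Φ 0 + ∫ y in (0 : ℝ)..x, ρ y := by
    funext x
    have := intervalIntegral.integral_Iic_sub_Iic (a := 0) (b := x)
      rho_int.integrableOn rho_int.integrableOn
    unfold Φ
    linarith
  rw [h]
  exact (intervalIntegral.integral_hasDerivAt_right (rho_cont.intervalIntegrable _ _)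
    (rho_cont.stronglyMeasurableAtFilter _ _) rho_cont.continuousAt).const_add _

theorem P_eq (y : ℝ) : (∫ t : ℝ, ind (y - t ^ 3) * ρ t) = Φ (cbrt y) := by
  unfold Φ
  rw [MeasureTheory.integral_Iic_eq_integral_Iio, ← MeasureTheory.integral_indicator measurableSet_Iio]
  congr 1
  funext t
  have hm : t ^ 3 < y ↔ t < cbrt y := by
    conv_lhs => rw [← cbrt_cube y]
    exact (Odd.strictMono_pow (by decide)).lt_iff_lt
  by_cases h : t < cbrt y
  · rw [Set.indicator_of_mem (by exact h)]
    simp [ind, hm.2 h]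
  · rw [Set.indicator_of_notMem (by exact h)]
    simp [ind, mt hm.1 h]

/-- **Example 4 of the paper (cubic).**  For `f(y₁,y₂) = ind(y₂ − y₁³)` and
`(P₁ f)(y₂) = ∫_ℝ f(y₁,y₂) ρ(y₁) dy₁`, one has `(P₁ f)(y₂) = Φ(∛y₂)` for every `y₂`, and
`((P₁ f)(y₂) − 1/2)/∛y₂ → ρ(0)` as `y₂ → 0` (`y₂ ≠ 0`).  Consequently `P₁ f` has a
cube-root singularity at `y₂ = 0`: the difference quotient `((P₁ f)(y₂) − 1/2)/y₂` tends to
`+∞` as `y₂ → 0`, so `P₁ f` is not differentiable at `0`. -/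
theorem preintegration_cubic :
    (∀ y₂ : ℝ, (∫ y₁ : ℝ, ind (y₂ - y₁ ^ 3) * ρ y₁) = Φ (cbrt y₂)) ∧
    Tendsto (fun y₂ : ℝ => ((∫ y₁ : ℝ, ind (y₂ - y₁ ^ 3) * ρ y₁) - 1 / 2) / cbrt y₂)
      (𝓝[≠] 0) (𝓝 (ρ 0)) ∧
    Tendsto (fun y₂ : ℝ => ((∫ y₁ : ℝ, ind (y₂ - y₁ ^ 3) * ρ y₁) - 1 / 2) / y₂)
      (𝓝[≠] 0) atTop ∧
    ¬ DifferentiableAt ℝ (fun y₂ : ℝ => ∫ y₁ : ℝ, ind (y₂ - y₁ ^ 3) * ρ y₁) 0 := by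
  simp only [P_eq]
  have h2 : Tendsto (fun y₂ : ℝ => (Φ (cbrt y₂) - 1 / 2) / cbrt y₂) (𝓝[≠] 0) (𝓝 (ρ 0)) := by
    have h := (hasDerivAt_iff_tendsto_slope.1 Phi_deriv).comp cbrt_tendsto
    refine h.congr fun y => ?_
    simp [slope_def_field, Phi_zero]
  have h3 : Tendsto (fun y₂ : ℝ => (Φ (cbrt y₂) - 1 / 2) / y₂) (𝓝[≠] 0) atTop := by
    have hp : 0 < ρ 0 := by unfold ρ; positivity
    have hs : Tendsto (fun y : ℝ => (cbrt y ^ 2)⁻¹) (𝓝[≠] 0) atTop := by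
      apply Tendsto.inv_tendsto_nhdsGT_zero
      rw [tendsto_nhdsWithin_iff]
      have hc := tendsto_nhdsWithin_iff.1 cbrt_tendsto
      refine ⟨by simpa using hc.1.pow 2, ?_⟩
      filter_upwards [hc.2] with y hy
      have hy' : cbrt y ≠ 0 := hy
      show 0 < cbrt y ^ 2
      positivity
    refine (h2.pos_mul_atTop hp hs).congr fun y => ?_
    have e : cbrt y * cbrt y ^ 2 = y := by rw [← pow_succ', cbrt_cube]
    rw [← div_eq_mul_inv, div_div, e]
  refine ⟨fun _ => trivial, h2, h3, fun hd => ?_⟩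
  have h := hasDerivAt_iff_tendsto_slope.1 hd.hasDerivAt
  refine not_tendsto_nhds_of_tendsto_atTop h3 _ (h.congr fun y => ?_)
  have h0 : cbrt 0 = 0 := by simp [cbrt]
  simp [slope_def_field, Phi_zero, h0]
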